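/- arXiv:1910.10128 — 4 statements merged into one kernel-verified Lean document; each statement's English description precedes it below -/
import Mathlib

section
/- Let X be a real normed space, λ ∈ ℝ, and let F : X → ℝ ∪ {+∞} be proper and λ-convex. Then for every u ∈ X with F(u) < +∞ and every ξ ∈ X*, ξ belongs to the Fréchet subdifferential ∂F(u) if and only if F(u) ≤ F(v) + ⟨ξ, u − v⟩ + λ‖u − v‖² for all v ∈ X. -/
open Filter Topology

/-- The Fréchet subdifferential of `F : X → ℝ ∪ {+∞}` (modeled as `X → EReal`)
at a point `u`: the set of continuous linear functionals `ξ` such that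
`liminf_{v → u} (F v − F u − ⟨ξ, v − u⟩)/‖v − u‖ ≥ 0`. -/
noncomputable def frechetSubdiff {X : Type*} [NormedAddCommGroup X] [NormedSpace ℝ X]
    (F : X → EReal) (u : X) : Set (X →L[ℝ] ℝ) :=
  {ξ | 0 ≤ liminf
      (fun v => (F v - F u - ((ξ (v - u) : ℝ) : EReal)) / ((‖v - u‖ : ℝ) : EReal))
      (𝓝[≠] u)}

/-- `F` is `λ`-convex: `F(tu + (1−t)v) ≤ tF(u) + (1−t)F(v) + λ t(1−t)‖u − v‖²`
for all `u, v` in the effective domain and `t ∈ (0,1)`. -/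
def LambdaConvex {X : Type*} [NormedAddCommGroup X] [NormedSpace ℝ X]
    (lam : ℝ) (F : X → EReal) : Prop :=
  ∀ u v : X, F u ≠ ⊤ → F v ≠ ⊤ → ∀ t : ℝ, t ∈ Set.Ioo (0 : ℝ) 1 →
    F (t • u + (1 - t) • v) ≤
      ((t : ℝ) : EReal) * F u + (((1 - t : ℝ)) : EReal) * F v +
        ((lam * t * (1 - t) * ‖u - v‖ ^ 2 : ℝ) : EReal)

/-- A function `g` has nonnegative lower limit along a filter iff it is eventually
above every negative real number. -/
theorem zero_le_liminf_iff_forall_neg {α : Type*} {l : Filter α} {g : α → EReal} :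
    0 ≤ liminf g l ↔ ∀ ε : ℝ, 0 < ε → ∀ᶠ a in l, ((-ε : ℝ) : EReal) < g a := by
  rw [le_liminf_iff]
  constructor
  · intro h ε hε
    exact h _ (by exact_mod_cast neg_lt_zero.mpr hε)
  · intro h y hy
    obtain ⟨r, hyr, hr⟩ := EReal.lt_iff_exists_real_btwn.mp hy
    have hr0 : r < 0 := by exact_mod_cast hr
    filter_upwards [h (-r) (by linarith)] with a ha
    rw [neg_neg] at ha
    exact hyr.trans ha

/-- A `λ`-convex function satisfies the global inequality at every Fréchet subgradient. -/
theorem LambdaConvex.le_of_mem_frechetSubdiff {X : Type*} [NormedAddCommGroup X]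
    [NormedSpace ℝ X] {lam : ℝ} {F : X → EReal} (hbot : ∀ x, F x ≠ ⊥)
    (hconv : LambdaConvex lam F) {u : X} (hu : F u ≠ ⊤) {ξ : X →L[ℝ] ℝ}
    (hξ : ξ ∈ frechetSubdiff F u) (v : X) :
    F u ≤ F v + ((ξ (u - v) + lam * ‖u - v‖ ^ 2 : ℝ) : EReal) := by
  rcases eq_or_ne v u with rfl | hvu
  · simp
  by_cases hv : F v = ⊤
  · rw [hv, EReal.top_add_coe]
    exact le_top
  have hn : 0 < ‖v - u‖ := norm_pos_iff.mpr (sub_ne_zero.mpr hvu)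
  obtain ⟨a, ha⟩ : ∃ a : ℝ, F u = a := ⟨_, (EReal.coe_toReal hu (hbot u)).symm⟩
  obtain ⟨b, hb⟩ : ∃ b : ℝ, F v = b := ⟨_, (EReal.coe_toReal hv (hbot v)).symm⟩
  have hsub : ∀ t : ℝ, t • v + (1 - t) • u - u = t • (v - u) := fun t => by module
  have hlim : Tendsto (fun t : ℝ => t • v + (1 - t) • u) (𝓝[>] 0) (𝓝[≠] u) := by
    refine tendsto_nhdsWithin_iff.mpr ⟨?_, ?_⟩
    · have hc : Continuous fun t : ℝ => t • v + (1 - t) • u := by fun_prop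
      simpa using (hc.tendsto 0).mono_left nhdsWithin_le_nhds
    · filter_upwards [self_mem_nhdsWithin] with t (ht : 0 < t)
      exact sub_ne_zero.mp (by
        rw [hsub]; exact smul_ne_zero ht.ne' (sub_ne_zero.mpr hvu))
  have key : ∀ ε : ℝ, 0 < ε →
      -ε * ‖v - u‖ ≤ b - a + lam * ‖v - u‖ ^ 2 - ξ (v - u) := by
    intro ε hε
    have hc : Continuous fun t : ℝ => b - a + lam * (1 - t) * ‖v - u‖ ^ 2 - ξ (v - u) := by
      fun_prop
    have hT : Tendsto (fun t : ℝ => b - a + lam * (1 - t) * ‖v - u‖ ^ 2 - ξ (v - u))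
        (𝓝[>] 0) (𝓝 (b - a + lam * ‖v - u‖ ^ 2 - ξ (v - u))) := by
      simpa using (hc.tendsto 0).mono_left nhdsWithin_le_nhds
    refine ge_of_tendsto hT ?_
    filter_upwards [hlim.eventually (zero_le_liminf_iff_forall_neg.mp hξ ε hε),
      Ioo_mem_nhdsGT (zero_lt_one (α := ℝ))] with t hq ht
    have hle := hconv v u hv hu t ht
    rw [ha, hb] at hle
    norm_cast at hle
    obtain ⟨c, hc⟩ : ∃ c : ℝ, F (t • v + (1 - t) • u) = c :=
      ⟨_, (EReal.coe_toReal (ne_top_of_le_ne_top (EReal.coe_ne_top _) hle) (hbot _)).symm⟩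
    rw [hc] at hle
    rw [hc, ha, hsub, norm_smul, map_smul, Real.norm_of_nonneg ht.1.le] at hq
    norm_cast at hle hq
    rw [← EReal.coe_div, EReal.coe_lt_coe_iff, smul_eq_mul, lt_div_iff₀ (mul_pos ht.1 hn)] at hq
    refine le_of_mul_le_mul_left ?_ ht.1
    linarith
  have hlim' : 0 ≤ b - a + lam * ‖v - u‖ ^ 2 - ξ (v - u) := by
    by_contra! hneg
    have h := key (-(b - a + lam * ‖v - u‖ ^ 2 - ξ (v - u)) / (2 * ‖v - u‖))
      (by apply div_pos <;> linarith)
    have he : -(-(b - a + lam * ‖v - u‖ ^ 2 - ξ (v - u)) / (2 * ‖v - u‖)) * ‖v - u‖ =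
        (b - a + lam * ‖v - u‖ ^ 2 - ξ (v - u)) / 2 := by
      field_simp
    linarith
  rw [ha, hb, norm_sub_rev u v, ← neg_sub v u, map_neg]
  norm_cast
  linarith

/-- The global quadratic lower bound implies membership in the Fréchet subdifferential. -/
theorem mem_frechetSubdiff_of_forall_le {X : Type*} [NormedAddCommGroup X]
    [NormedSpace ℝ X] {lam : ℝ} {F : X → EReal} (hbot : ∀ x, F x ≠ ⊥)
    {u : X} (hu : F u ≠ ⊤) {ξ : X →L[ℝ] ℝ}
    (h : ∀ v : X, F u ≤ F v + ((ξ (u - v) + lam * ‖u - v‖ ^ 2 : ℝ) : EReal)) :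
    ξ ∈ frechetSubdiff F u := by
  refine zero_le_liminf_iff_forall_neg.mpr fun ε hε => ?_
  obtain ⟨a, ha⟩ : ∃ a : ℝ, F u = a := ⟨_, (EReal.coe_toReal hu (hbot u)).symm⟩
  have hsmall : ∀ᶠ v in 𝓝[≠] u, lam * ‖v - u‖ < ε := by
    have hc : Continuous fun v : X => lam * ‖v - u‖ := by fun_prop
    exact ((hc.tendsto u).mono_left nhdsWithin_le_nhds).eventually_lt_const (by simpa using hε)
  filter_upwards [hsmall, self_mem_nhdsWithin] with v hv (hvu : v ≠ u)
  have hn : 0 < ‖v - u‖ := norm_pos_iff.mpr (sub_ne_zero.mpr hvu)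
  by_cases hvt : F v = ⊤
  · rw [hvt, ha, EReal.top_sub_coe, EReal.top_sub_coe,
      EReal.top_div_of_pos_ne_top (by exact_mod_cast hn) (EReal.coe_ne_top _)]
    exact EReal.coe_lt_top _
  obtain ⟨b, hb⟩ : ∃ b : ℝ, F v = b := ⟨_, (EReal.coe_toReal hvt (hbot v)).symm⟩
  have hle := h v
  rw [ha, hb, norm_sub_rev u v, ← neg_sub v u, map_neg] at hle
  rw [ha, hb]
  norm_cast at hle ⊢
  rw [← EReal.coe_div, EReal.coe_lt_coe_iff, lt_div_iff₀ hn]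
  nlinarith

/-- For a proper `λ`-convex function `F`, `ξ ∈ ∂F(u)` (Fréchet subdifferential) iff
`F(u) ≤ F(v) + ⟨ξ, u − v⟩ + λ‖u − v‖²` for all `v`. -/
theorem frechetSubdiff_lambdaConvex_iff {X : Type*} [NormedAddCommGroup X] [NormedSpace ℝ X]
    (lam : ℝ) (F : X → EReal) (hbot : ∀ x, F x ≠ ⊥) (hproper : ∃ x, F x ≠ ⊤)
    (hconv : LambdaConvex lam F) (u : X) (hu : F u ≠ ⊤) (ξ : X →L[ℝ] ℝ) :
    ξ ∈ frechetSubdiff F u ↔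
      ∀ v : X, F u ≤ F v + ((ξ (u - v) + lam * ‖u - v‖ ^ 2 : ℝ) : EReal) := by
  exact ⟨hconv.le_of_mem_frechetSubdiff hbot hu, mem_frechetSubdiff_of_forall_le hbot hu⟩
end

section
/- Let X be a real normed space, λ ∈ ℝ, and let F : X → ℝ ∪ {+∞} be proper and λ-convex. Then for all u, v ∈ X with F(u) < +∞ and F(v) < +∞, and all ξ in the Fréchet subdifferential ∂F(u) and ζ in the Fréchet subdifferential ∂F(v), one has ⟨ξ − ζ, u − v⟩ ≥ −2λ‖u − v‖². In particular, for λ < 0 the Fréchet subdifferential of F is strongly monotone. -/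
open Filter Topology

/-- A Fréchet subgradient of a `λ`-convex function satisfies the subgradient inequality globally,
up to the error `λ ‖v - u‖ ^ 2`. -/
lemma apply_sub_le_of_mem_frechetSubdiff {X : Type*} [NormedAddCommGroup X] [NormedSpace ℝ X]
    {lam : ℝ} {F : X → EReal} (hbot : ∀ x, F x ≠ ⊥) (hconv : LambdaConvex lam F) {u v : X}
    (hu : F u ≠ ⊤) (hv : F v ≠ ⊤) (huv : v ≠ u) {ξ : X →L[ℝ] ℝ} (hξ : ξ ∈ frechetSubdiff F u) :
    ξ (v - u) ≤ (F v).toReal - (F u).toReal + lam * ‖v - u‖ ^ 2 := by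
  have hn : 0 < ‖v - u‖ := norm_pos_iff.2 (sub_ne_zero.2 huv)
  suffices h : ∀ ε : ℝ, 0 < ε → ξ (v - u) - ε * ‖v - u‖ ≤
      (F v).toReal - (F u).toReal + lam * ‖v - u‖ ^ 2 by
    refine le_of_forall_pos_le_add fun δ hδ => ?_
    have := h (δ / ‖v - u‖) (by positivity)
    rw [div_mul_cancel₀ _ hn.ne'] at this
    linarith
  intro ε hε
  have hlim : Tendsto (fun t : ℝ => t • v + (1 - t) • u) (𝓝[>] 0) (𝓝[≠] u) := by
    refine tendsto_nhdsWithin_iff.2 ⟨?_, ?_⟩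
    · have hc : Continuous fun t : ℝ => t • v + (1 - t) • u := by fun_prop
      simpa using (hc.tendsto 0).mono_left nhdsWithin_le_nhds
    · filter_upwards [self_mem_nhdsWithin] with t ht h
      have h' : t • (v - u) = 0 := by
        rw [← sub_eq_zero.2 h]
        module
      exact (smul_ne_zero (ne_of_gt ht) (sub_ne_zero.2 huv)) h'
  have hlt : ((-ε : ℝ) : EReal) < liminf
      (fun w => (F w - F u - ((ξ (w - u) : ℝ) : EReal)) / ((‖w - u‖ : ℝ) : EReal)) (𝓝[≠] u) :=
    lt_of_lt_of_le (by exact_mod_cast neg_lt_zero.2 hε) hξ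
  have hev := hlim.eventually (eventually_lt_of_lt_liminf hlt)
  have hrhs : Tendsto (fun t : ℝ => (F v).toReal - (F u).toReal + lam * (1 - t) * ‖v - u‖ ^ 2)
      (𝓝[>] 0) (𝓝 ((F v).toReal - (F u).toReal + lam * ‖v - u‖ ^ 2)) := by
    have hc : Continuous fun t : ℝ =>
        (F v).toReal - (F u).toReal + lam * (1 - t) * ‖v - u‖ ^ 2 := by fun_prop
    simpa using (hc.tendsto 0).mono_left nhdsWithin_le_nhds
  refine ge_of_tendsto hrhs ?_
  filter_upwards [hev, Ioo_mem_nhdsGT (zero_lt_one' ℝ)] with t h1 ht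
  have h2 := hconv v u hv hu t ht
  have hw : t • v + (1 - t) • u - u = t • (v - u) := by module
  rw [hw, norm_smul, Real.norm_of_nonneg ht.1.le, map_smul, smul_eq_mul] at h1
  generalize t • v + (1 - t) • u = w at h1 h2
  lift F u to ℝ using ⟨hu, hbot u⟩ with a
  lift F v to ℝ using ⟨hv, hbot v⟩ with b
  have hwt : F w ≠ ⊤ := by
    refine ne_top_of_le_ne_top ?_ h2
    norm_cast
    exact EReal.coe_ne_top _
  lift F w to ℝ using ⟨hwt, hbot w⟩ with c
  norm_cast at h1 h2
  rw [← EReal.coe_div, EReal.coe_lt_coe_iff, lt_div_iff₀ (mul_pos ht.1 hn)] at h1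
  simp only [EReal.toReal_coe]
  refine le_of_mul_le_mul_left ?_ ht.1
  linarith

/-- For a proper `λ`-convex function `F` the Fréchet subdifferential satisfies
`⟨ξ − ζ, u − v⟩ ≥ −2λ‖u − v‖²` for `ξ ∈ ∂F(u)`, `ζ ∈ ∂F(v)`;
in particular, for `λ < 0` it is strongly monotone. -/
theorem frechetSubdiff_lambdaConvex_strongMono {X : Type*}
    [NormedAddCommGroup X] [NormedSpace ℝ X]
    (lam : ℝ) (F : X → EReal) (hbot : ∀ x, F x ≠ ⊥) (hproper : ∃ x, F x ≠ ⊤)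
    (hconv : LambdaConvex lam F) (u v : X) (hu : F u ≠ ⊤) (hv : F v ≠ ⊤)
    (ξ ζ : X →L[ℝ] ℝ) (hξ : ξ ∈ frechetSubdiff F u) (hζ : ζ ∈ frechetSubdiff F v) :
    -2 * lam * ‖u - v‖ ^ 2 ≤ (ξ - ζ) (u - v) := by
  rcases eq_or_ne u v with rfl | huv
  · simp
  have h1 := apply_sub_le_of_mem_frechetSubdiff hbot hconv hu hv huv.symm hξ
  have h2 := apply_sub_le_of_mem_frechetSubdiff hbot hconv hv hu huv hζ
  rw [norm_sub_rev] at h1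
  rw [← neg_sub u v, map_neg] at h1
  rw [sub_apply]
  linarith
end

section
/- (Attouch–Brezis) Let X be a real Banach space and let F₁, F₂ : X → ℝ ∪ {+∞} be proper, lower semicontinuous and convex such that the set ⋃_{λ ≥ 0} λ·(dom F₁ − dom F₂) is a closed linear subspace of X. Then for every ξ ∈ X* the infimum inf_{η ∈ X*} (F₁*(ξ − η) + F₂*(η)) is attained at some η ∈ X*, and its value equals (F₁ + F₂)*(ξ). -/
open Filter Topology Pointwise

/-- Convexity of an extended-real-valued function. -/
def ERealConvex {X : Type*} [NormedAddCommGroup X] [NormedSpace ℝ X]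
    (F : X → EReal) : Prop :=
  ∀ u v : X, ∀ t : ℝ, t ∈ Set.Ioo (0 : ℝ) 1 →
    F (t • u + (1 - t) • v) ≤ ((t : ℝ) : EReal) * F u + (((1 - t : ℝ)) : EReal) * F v

/-- The convex conjugate (Legendre–Fenchel transform) of `F : X → ℝ ∪ {+∞}`:
`F*(ξ) = sup_{u ∈ X} (⟨ξ, u⟩ − F(u))`. -/
noncomputable def legendreFenchel {X : Type*} [NormedAddCommGroup X] [NormedSpace ℝ X]
    (F : X → EReal) (ξ : X →L[ℝ] ℝ) : EReal :=
  ⨆ u : X, ((ξ u : ℝ) : EReal) - F u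

/-- If every point `s` of norm less than `δ` in `S` is within `δ / 2` of the image of the bounded
closed convex set `C` under `T`, then twice that image covers the ball of radius `δ` in `S`. -/
theorem Convex.exists_mem_map_eq_of_approx {Y Z : Type*} [NormedAddCommGroup Y] [NormedSpace ℝ Y]
    [NormedAddCommGroup Z] [NormedSpace ℝ Z] [CompleteSpace Z] (T : Z →L[ℝ] Y) {C : Set Z}
    (hconv : Convex ℝ C) (hclosed : IsClosed C) {r : ℝ} (hr : ∀ z ∈ C, ‖z‖ ≤ r)
    (S : Submodule ℝ Y) (hTC : ∀ z ∈ C, T z ∈ S) {δ : ℝ}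
    (happrox : ∀ s ∈ S, ‖s‖ < δ → ∃ z ∈ C, ‖s - T z‖ < δ / 2)
    {s : Y} (hs : s ∈ S) (hsδ : ‖s‖ < δ) : ∃ z ∈ C, (2 : ℝ) • T z = s := by
  choose! g hgC hg using happrox
  let σ : ℕ → Y := fun n => (fun x => (2 : ℝ) • (x - T (g x)))^[n] s
  have hσ0 : σ 0 = s := rfl
  have hσ1 : ∀ n, σ (n + 1) = (2 : ℝ) • (σ n - T (g (σ n))) := fun n => by
    simp only [σ, Function.iterate_succ_apply']
  have hσ : ∀ n, σ n ∈ S ∧ ‖σ n‖ < δ := by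
    intro n
    induction n with
    | zero => exact ⟨hs, hsδ⟩
    | succ n ih =>
      rw [hσ1]
      refine ⟨S.smul_mem _ (S.sub_mem ih.1 (hTC _ (hgC _ ih.1 ih.2))), ?_⟩
      have := hg _ ih.1 ih.2
      rw [norm_smul, Real.norm_ofNat]
      linarith
  let z : ℕ → Z := fun n => g (σ n)
  have hz : ∀ n, z n ∈ C := fun n => hgC _ (hσ n).1 (hσ n).2
  let y : ℕ → Z := fun n => ∑ k ∈ Finset.range n, ((1 / 2 : ℝ) ^ k * (1 / 2)) • z k
  have hpow : Tendsto (fun n : ℕ => (1 / 2 : ℝ) ^ n) atTop (𝓝 0) :=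
    tendsto_pow_atTop_nhds_zero_of_lt_one (by norm_num) (by norm_num)
  have hyC : ∀ n, ∀ c ∈ C, y n + (1 / 2 : ℝ) ^ n • c ∈ C := by
    intro n
    induction n with
    | zero => intro c hc; simpa [y] using hc
    | succ n ih =>
      intro c hc
      have h := ih _ (hconv (hz n) hc (by norm_num : (0 : ℝ) ≤ 1 / 2)
        (by norm_num : (0 : ℝ) ≤ 1 / 2) (by norm_num))
      convert h using 1
      simp only [y, Finset.sum_range_succ]
      module
  have hTy : ∀ n, s = (2 : ℝ) • T (y n) + (1 / 2 : ℝ) ^ n • σ n := by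
    intro n
    induction n with
    | zero => simp [y, hσ0]
    | succ n ih =>
      refine ih.trans ?_
      simp only [y, z, Finset.sum_range_succ, hσ1, map_add, map_smul]
      module
  have hsum : Summable (fun k : ℕ => ((1 / 2 : ℝ) ^ k * (1 / 2)) • z k) := by
    refine Summable.of_norm_bounded (g := fun k : ℕ => (1 / 2 : ℝ) ^ k * (1 / 2 * r))
      ((summable_geometric_of_lt_one (by norm_num) (by norm_num)).mul_right _) fun k => ?_
    rw [norm_smul, Real.norm_of_nonneg (by positivity), mul_assoc]
    gcongr
    exact hr _ (hz k)
  have hy := hsum.hasSum.tendsto_sum_nat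
  refine ⟨∑' k : ℕ, ((1 / 2 : ℝ) ^ k * (1 / 2)) • z k, hclosed.mem_of_tendsto (b := atTop) ?_
    (Eventually.of_forall fun n => hyC n _ (hz 0)), ?_⟩
  · have h := hy.add (hpow.smul_const (z 0))
    rwa [zero_smul, add_zero] at h
  · have h1 : Tendsto (fun n => (1 / 2 : ℝ) ^ n • σ n) atTop (𝓝 0) := by
      refine squeeze_zero_norm (a := fun n : ℕ => (1 / 2 : ℝ) ^ n * δ) (fun n => ?_)
        (by simpa using hpow.mul_const δ)
      rw [norm_smul, Real.norm_of_nonneg (by positivity)]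
      gcongr
      exact (hσ n).2.le
    have h2 := (((T.continuous.tendsto _).comp hy).const_smul (2 : ℝ)).add h1
    rw [add_zero] at h2
    refine tendsto_nhds_unique h2 ?_
    exact tendsto_const_nhds.congr hTy

theorem Convex.exists_map_eq_zero {Y Z : Type*} [NormedAddCommGroup Y] [NormedSpace ℝ Y]
    [NormedAddCommGroup Z] [NormedSpace ℝ Z] (T : Z →L[ℝ] Y) {C : Set Z} (hconv : Convex ℝ C)
    (S : Submodule ℝ Y) (hTC : ∀ z ∈ C, T z ∈ S)
    (hS : ∀ s ∈ S, ∃ l : ℝ, 0 ≤ l ∧ ∃ z ∈ C, s = l • T z) : ∃ z ∈ C, T z = 0 := by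
  obtain ⟨-, -, z, hz, -⟩ := hS 0 S.zero_mem
  obtain ⟨l, hl, w, hw, hzw⟩ := hS _ (S.neg_mem (hTC z hz))
  refine ⟨_, hconv hz hw (a := 1 / (1 + l)) (b := l / (1 + l)) (by positivity) (by positivity)
    (by field_simp), ?_⟩
  have h : T z = -(l • T w) := by rw [← hzw, neg_neg]
  simp only [map_add, map_smul, h]
  module

/-- If the cone generated by the image of a closed convex set `C` under `T` is a closed subspace
`S`, then the image of some bounded part of `C` is a neighbourhood of `0` in `S`. -/
theorem Convex.exists_ball_subset_image {Y Z : Type*} [NormedAddCommGroup Y] [NormedSpace ℝ Y]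
    [NormedAddCommGroup Z] [NormedSpace ℝ Z] [CompleteSpace Z] (T : Z →L[ℝ] Y) {C : Set Z}
    (hconv : Convex ℝ C) (hclosed : IsClosed C)
    (S : Submodule ℝ Y) [CompleteSpace S] (hTC : ∀ z ∈ C, T z ∈ S)
    (hS : ∀ s ∈ S, ∃ l : ℝ, 0 ≤ l ∧ ∃ z ∈ C, s = l • T z) :
    ∃ δ > 0, ∃ r : ℝ, ∀ s ∈ S, ‖s‖ < δ → ∃ z ∈ C, ‖z‖ ≤ r ∧ T z = s := by
  obtain ⟨z₀, hz₀C, hz₀⟩ := hconv.exists_map_eq_zero T S hTC hS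
  let P : ℕ → Set Z := fun n => C ∩ Metric.closedBall 0 n
  have hPconv : ∀ n, Convex ℝ (P n) := fun n => hconv.inter (convex_closedBall _ _)
  let K : ℕ → Set S := fun n => {s | (∃ z ∈ P n, T z = s) ∧ ∃ z ∈ P n, T z = -s}
  have hKconv : ∀ n, Convex ℝ (K n) := by
    rintro n s ⟨⟨z, hz, hzs⟩, w, hw, hws⟩ s' ⟨⟨z', hz', hzs'⟩, w', hw', hws'⟩ a b ha hb hab
    refine ⟨⟨_, hPconv n hz hz' ha hb hab, ?_⟩, _, hPconv n hw hw' ha hb hab, ?_⟩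
    · simp [hzs, hzs']
    · simp only [map_add, map_smul, hws, hws', Submodule.coe_add, Submodule.coe_smul]
      module
  have hKneg : ∀ n, ∀ s ∈ closure (K n), -s ∈ closure (K n) := by
    intro n s hs
    refine map_mem_closure continuous_neg hs fun t ht => ?_
    exact ⟨by simpa using ht.2, by simpa using ht.1⟩
  have hcover : ∀ s ∈ S, ∃ N : ℕ, ∀ n ≥ N, ∃ z ∈ P n, T z = ((n : ℝ) + 1)⁻¹ • s := by
    intro s hs
    obtain ⟨l, hl, z, hz, rfl⟩ := hS s hs
    obtain ⟨N, hN⟩ := exists_nat_ge (max l (max ‖z‖ ‖z₀‖))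
    refine ⟨N, fun n hn => ?_⟩
    have hn' : (N : ℝ) ≤ n := by exact_mod_cast hn
    simp only [max_le_iff] at hN
    have hz' : z ∈ P n := ⟨hz, by simpa using hN.2.1.trans hn'⟩
    have hz₀' : z₀ ∈ P n := ⟨hz₀C, by simpa using hN.2.2.trans hn'⟩
    have hle : ((n : ℝ) + 1)⁻¹ * l ≤ 1 := by
      rw [inv_mul_le_iff₀ (by positivity)]
      linarith
    refine ⟨_, hPconv n hz' hz₀' (a := ((n : ℝ) + 1)⁻¹ * l) (b := 1 - ((n : ℝ) + 1)⁻¹ * l)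
      (by positivity) (by linarith) (by ring), ?_⟩
    simp [hz₀, mul_smul]
  let W : ℕ → Set S := fun n => {s | ((n : ℝ) + 1)⁻¹ • s ∈ closure (K n)}
  obtain ⟨n, p, hp⟩ : ∃ n, (interior (W n)).Nonempty := by
    refine nonempty_interior_of_iUnion_of_closed
      (fun n => isClosed_closure.preimage (continuous_const_smul _)) ?_
    refine Set.eq_univ_of_forall fun s => ?_
    obtain ⟨N, hN⟩ := hcover s s.2
    obtain ⟨M, hM⟩ := hcover (-s) (S.neg_mem s.2)
    refine Set.mem_iUnion.2 ⟨max N M, subset_closure ⟨?_, ?_⟩⟩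
    · simpa using hN _ (le_max_left _ _)
    · simpa using hM _ (le_max_right _ _)
  obtain ⟨ε, hε, hball⟩ := Metric.mem_nhds_iff.1 (mem_interior_iff_mem_nhds.1 hp)
  have hclos : ∀ s : S, ‖s‖ < ((n : ℝ) + 1)⁻¹ * ε → s ∈ closure (K n) := by
    intro s hs
    have hlt : ‖((n : ℝ) + 1) • s‖ < ε := by
      rw [norm_smul, Real.norm_of_nonneg (by positivity)]
      rwa [lt_inv_mul_iff₀ (by positivity)] at hs
    have h1 : p + ((n : ℝ) + 1) • s ∈ W n := hball (by simpa using hlt)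
    have h2 : p - ((n : ℝ) + 1) • s ∈ W n := hball (by simpa [dist_eq_norm] using hlt)
    have h := (hKconv n).closure h1 (hKneg n _ h2) (by norm_num : (0 : ℝ) ≤ 1 / 2)
        (by norm_num : (0 : ℝ) ≤ 1 / 2) (by norm_num)
    convert h using 1
    have : (n : ℝ) + 1 ≠ 0 := by positivity
    match_scalars <;> field_simp <;> ring
  have hδ : 0 < ((n : ℝ) + 1)⁻¹ * ε := by positivity
  refine ⟨((n : ℝ) + 1)⁻¹ * ε / 2, by positivity, n, fun s hs hlt => ?_⟩
  obtain ⟨z, hz, hzs⟩ := (hPconv n).exists_mem_map_eq_of_approx T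
    (hclosed.inter Metric.isClosed_closedBall) (r := n) (fun z hz => by simpa using hz.2) S
    (fun z hz => hTC z hz.1) (δ := ((n : ℝ) + 1)⁻¹ * ε) (fun s hs hlt => by
      obtain ⟨t, ⟨⟨z, hz, hzt⟩, -⟩, ht⟩ :=
        Metric.mem_closure_iff.1 (hclos ⟨s, hs⟩ hlt) _ (half_pos hδ)
      refine ⟨z, hz, ?_⟩
      rw [hzt]
      simpa [dist_eq_norm] using ht)
    (S.smul_mem 2 hs) (by rw [norm_smul, Real.norm_ofNat]; linarith)
  exact ⟨z, hz.1, by simpa using hz.2, smul_right_injective Y (two_ne_zero (α := ℝ)) hzs⟩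

/-- Lagrange duality: a lower bound `a` of a continuous linear functional `c` on the points of a
closed convex set `C` with `T z = 0` persists on all of `C` after adding a multiplier of `T z`. -/
theorem Convex.exists_lagrange_multiplier {Y Z : Type*} [NormedAddCommGroup Y] [NormedSpace ℝ Y]
    [NormedAddCommGroup Z] [NormedSpace ℝ Z] [CompleteSpace Z] (T : Z →L[ℝ] Y) {C : Set Z}
    (hconv : Convex ℝ C) (hclosed : IsClosed C)
    (S : Submodule ℝ Y) [CompleteSpace S] (hTC : ∀ z ∈ C, T z ∈ S)
    (hS : ∀ s ∈ S, ∃ l : ℝ, 0 ≤ l ∧ ∃ z ∈ C, s = l • T z)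
    (c : Z →L[ℝ] ℝ) {a : ℝ} (hc : ∀ z ∈ C, T z = 0 → a ≤ c z) :
    ∃ η : Y →L[ℝ] ℝ, ∀ z ∈ C, a + η (T z) ≤ c z := by
  obtain ⟨δ, hδ, r, hball⟩ := hconv.exists_ball_subset_image T hclosed S hTC hS
  let E : Set (S × ℝ) := {p | ∃ z ∈ C, T z = p.1 ∧ c z - a < p.2}
  have hEconv : Convex ℝ E := by
    rintro p ⟨z, hz, hzp, hlt⟩ q ⟨w, hw, hwq, hlt'⟩ b d hb hd hbd
    refine ⟨_, hconv hz hw hb hd hbd, by simp [hzp, hwq], ?_⟩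
    simp only [map_add, map_smul, smul_eq_mul, Prod.snd_add, Prod.smul_snd]
    rcases hb.eq_or_lt with rfl | hb
    · obtain rfl : d = 1 := by linarith
      simpa using hlt'
    · have ha : a = b * a + d * a := by rw [← add_mul, hbd, one_mul]
      have h := mul_lt_mul_of_pos_left hlt hb
      have h' := mul_le_mul_of_nonneg_left hlt'.le hd
      linarith
  have h0E : (0 : S × ℝ) ∉ E := by
    rintro ⟨z, hz, hzp, hlt⟩
    exact (hc z hz (by simpa using hzp)).not_gt (by simpa using hlt)
  have hEint : ∀ s : S, ‖s‖ < δ → ∀ t : ℝ, ‖c‖ * r - a < t → (s, t) ∈ interior E := by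
    intro s hs t ht
    refine mem_interior.2 ⟨Metric.ball 0 δ ×ˢ Set.Ioi (‖c‖ * r - a), ?_,
      Metric.isOpen_ball.prod isOpen_Ioi, by simpa using hs, ht⟩
    rintro ⟨s', t'⟩ ⟨hs', ht'⟩
    obtain ⟨z, hz, hzr, hzs⟩ := hball s' s'.2 (by simpa using hs')
    refine ⟨z, hz, hzs, lt_of_le_of_lt ?_ ht'⟩
    gcongr
    exact (le_abs_self _).trans ((c.le_opNorm z).trans (by gcongr))
  have hmem := hEint 0 (by simpa using hδ) (max (‖c‖ * r - a) 0 + 1)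
    ((le_max_left _ _).trans_lt (lt_add_one _))
  obtain ⟨f, hf⟩ := geometric_hahn_banach_open_point hEconv.interior isOpen_interior
    (fun h => h0E (interior_subset h))
  have hsplit : ∀ (s : S) (t : ℝ), f (s, t) = f (s, 0) + t * f (0, 1) := by
    intro s t
    rw [← smul_eq_mul, ← map_smul, ← map_add]
    simp
  have hneg : f (0, 1) < 0 := by
    have h := hf _ hmem
    rw [hsplit, ← Prod.zero_eq_mk, map_zero, zero_add] at h
    have : 0 < max (‖c‖ * r - a) 0 + 1 := by positivity
    exact neg_of_mul_neg_right h this.le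
  have hEle : ∀ p ∈ E, f p ≤ 0 := by
    intro p hp
    have hp' : p ∈ closure (interior E) := by
      rw [hEconv.closure_interior_eq_closure_of_nonempty_interior ⟨_, hmem⟩]
      exact subset_closure hp
    refine closure_minimal (fun q hq => ?_) (isClosed_le f.continuous continuous_const) hp'
    simpa using (hf q hq).le
  obtain ⟨η, hη, -⟩ := exists_extension_norm_eq S
    ((-f (0, 1))⁻¹ • f.comp (ContinuousLinearMap.inl ℝ S ℝ))
  refine ⟨η, fun z hz => ?_⟩
  rw [← le_sub_iff_add_le']
  refine le_of_forall_gt_imp_ge_of_dense fun t ht => ?_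
  have h := hEle (⟨T z, hTC z hz⟩, t) ⟨z, hz, rfl, ht⟩
  rw [hsplit] at h
  have h' := hη ⟨T z, hTC z hz⟩
  simp only [smul_apply, ContinuousLinearMap.comp_apply,
    ContinuousLinearMap.inl_apply, smul_eq_mul] at h'
  rw [h', inv_mul_le_iff₀ (by linarith)]
  linarith

theorem ERealConvex.le_combination {X : Type*} [NormedAddCommGroup X] [NormedSpace ℝ X]
    {F : X → EReal} (hF : ERealConvex F) {u v : X} {s t a b : ℝ} (hu : F u ≤ s) (hv : F v ≤ t)
    (ha : 0 ≤ a) (hb : 0 ≤ b) (hab : a + b = 1) :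
    F (a • u + b • v) ≤ ((a * s + b * t : ℝ) : EReal) := by
  rcases ha.eq_or_lt with rfl | ha
  · obtain rfl : b = 1 := by linarith
    simpa using hv
  rcases hb.eq_or_lt with rfl | hb
  · obtain rfl : a = 1 := by linarith
    simpa using hu
  obtain rfl : b = 1 - a := by linarith
  refine (hF u v a ⟨ha, by linarith⟩).trans ?_
  push_cast
  refine add_le_add (mul_le_mul_of_nonneg_left hu (by exact_mod_cast ha.le)) ?_
  exact mul_le_mul_of_nonneg_left hv (by exact_mod_cast hb.le)

theorem EReal.iSup_add_iSup_le {ι κ : Sort*} {f : ι → EReal} {g : κ → EReal} {a : EReal}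
    (h : ∀ i j, f i + g j ≤ a) : (⨆ i, f i) + ⨆ j, g j ≤ a := by
  refine EReal.add_le_of_forall_lt fun b hb c hc => ?_
  obtain ⟨i, hi⟩ := lt_iSup_iff.1 hb
  obtain ⟨j, hj⟩ := lt_iSup_iff.1 hc
  exact (add_le_add hi.le hj.le).trans (h i j)

theorem le_legendreFenchel {X : Type*} [NormedAddCommGroup X] [NormedSpace ℝ X]
    (F : X → EReal) (ξ : X →L[ℝ] ℝ) (u : X) : ((ξ u : ℝ) : EReal) - F u ≤ legendreFenchel F ξ :=
  le_iSup (fun u => ((ξ u : ℝ) : EReal) - F u) u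

theorem legendreFenchel_add_le {X : Type*} [NormedAddCommGroup X] [NormedSpace ℝ X]
    {F₁ F₂ : X → EReal} (hbot₁ : ∀ x, F₁ x ≠ ⊥) (hbot₂ : ∀ x, F₂ x ≠ ⊥) (ξ η : X →L[ℝ] ℝ) :
    legendreFenchel (fun x => F₁ x + F₂ x) ξ ≤
      legendreFenchel F₁ (ξ - η) + legendreFenchel F₂ η := by
  refine iSup_le fun u => le_trans (le_of_eq ?_)
    (add_le_add (le_legendreFenchel F₁ (ξ - η) u) (le_legendreFenchel F₂ η u))
  rcases eq_or_ne (F₁ u) ⊤ with h₁ | h₁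
  · simp [h₁, EReal.top_add_of_ne_bot (hbot₂ u)]
  rcases eq_or_ne (F₂ u) ⊤ with h₂ | h₂
  · simp [h₂, EReal.add_top_of_ne_bot (hbot₁ u)]
  lift F₁ u to ℝ using ⟨h₁, hbot₁ u⟩ with s
  lift F₂ u to ℝ using ⟨h₂, hbot₂ u⟩ with t
  norm_cast
  rw [sub_apply]
  ring

theorem isClosed_real_epigraph {X : Type*} [TopologicalSpace X] {F : X → EReal}
    (hF : LowerSemicontinuous F) : IsClosed {p : X × ℝ | F p.1 ≤ (p.2 : EReal)} :=
  hF.isClosed_epigraph.preimage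
    (continuous_fst.prodMk (continuous_coe_real_ereal.comp continuous_snd))

theorem ERealConvex.convex_real_epigraph {X : Type*} [NormedAddCommGroup X] [NormedSpace ℝ X]
    {F : X → EReal} (hF : ERealConvex F) : Convex ℝ {p : X × ℝ | F p.1 ≤ (p.2 : EReal)} :=
  fun _ hp _ hq _ _ ha hb hab => hF.le_combination hp hq ha hb hab

/-- (Attouch–Brezis) If `F₁, F₂ : X → ℝ ∪ {+∞}` are proper, lower semicontinuous and convex
on a Banach space `X` and `⋃_{λ ≥ 0} λ (dom F₁ − dom F₂)` is a closed linear subspace,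
then for every `ξ ∈ X*` the infimum `inf_η (F₁*(ξ − η) + F₂*(η))` is attained and equals
`(F₁ + F₂)*(ξ)`. -/
theorem attouch_brezis {X : Type*} [NormedAddCommGroup X] [NormedSpace ℝ X]
    [CompleteSpace X]
    (F₁ F₂ : X → EReal)
    (hbot₁ : ∀ x, F₁ x ≠ ⊥) (hbot₂ : ∀ x, F₂ x ≠ ⊥)
    (hproper₁ : ∃ x, F₁ x ≠ ⊤) (hproper₂ : ∃ x, F₂ x ≠ ⊤)
    (hlsc₁ : LowerSemicontinuous F₁) (hlsc₂ : LowerSemicontinuous F₂)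
    (hconv₁ : ERealConvex F₁) (hconv₂ : ERealConvex F₂)
    (S : Submodule ℝ X) (hSclosed : IsClosed (S : Set X))
    (hS : (S : Set X) =
      ⋃ (l : ℝ) (_ : 0 ≤ l), l • ({x | F₁ x ≠ ⊤} - {x | F₂ x ≠ ⊤})) :
    ∀ ξ : X →L[ℝ] ℝ, ∃ η : X →L[ℝ] ℝ,
      legendreFenchel F₁ (ξ - η) + legendreFenchel F₂ η =
        legendreFenchel (fun x => F₁ x + F₂ x) ξ ∧
      ∀ η' : X →L[ℝ] ℝ,
        legendreFenchel (fun x => F₁ x + F₂ x) ξ ≤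
          legendreFenchel F₁ (ξ - η') + legendreFenchel F₂ η' := by
  intro ξ
  suffices h : ∃ η : X →L[ℝ] ℝ, legendreFenchel F₁ (ξ - η) + legendreFenchel F₂ η ≤
      legendreFenchel (fun x => F₁ x + F₂ x) ξ by
    obtain ⟨η, hη⟩ := h
    exact ⟨η, hη.antisymm (legendreFenchel_add_le hbot₁ hbot₂ ξ η),
      legendreFenchel_add_le hbot₁ hbot₂ ξ⟩
  rcases eq_or_ne (legendreFenchel (fun x => F₁ x + F₂ x) ξ) ⊤ with htop | htop
  · exact ⟨0, htop ▸ le_top⟩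
  have : CompleteSpace S := hSclosed.completeSpace_coe
  let C : Set ((X × ℝ) × (X × ℝ)) :=
    {p | F₁ p.1 ≤ (p.2 : EReal)} ×ˢ {p | F₂ p.1 ≤ (p.2 : EReal)}
  let π : X × ℝ →L[ℝ] X := .fst ℝ X ℝ
  let τ : X × ℝ →L[ℝ] ℝ := .snd ℝ X ℝ
  let T : (X × ℝ) × (X × ℝ) →L[ℝ] X := π.coprod (-π)
  have hCconv : Convex ℝ C := hconv₁.convex_real_epigraph.prod hconv₂.convex_real_epigraph
  have hCclosed : IsClosed C :=
    (isClosed_real_epigraph hlsc₁).prod (isClosed_real_epigraph hlsc₂)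
  have hT : ∀ u v : X, ∀ s t : ℝ, T ((u, s), v, t) = u - v := fun u v s t => by
    simp [T, π, sub_eq_add_neg]
  have hTC : ∀ z ∈ C, T z ∈ S := by
    rintro ⟨⟨u, s⟩, v, t⟩ ⟨hu, hv⟩
    change F₁ u ≤ s at hu
    change F₂ v ≤ t at hv
    rw [← SetLike.mem_coe, hS]
    refine Set.mem_iUnion₂.2 ⟨1, zero_le_one, ?_⟩
    rw [one_smul]
    exact ⟨u, ne_top_of_le_ne_top (EReal.coe_ne_top s) hu, v,
      ne_top_of_le_ne_top (EReal.coe_ne_top t) hv, (hT u v s t).symm⟩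
  have hTS : ∀ x ∈ S, ∃ l : ℝ, 0 ≤ l ∧ ∃ z ∈ C, x = l • T z := by
    intro x hx
    rw [← SetLike.mem_coe, hS] at hx
    obtain ⟨l, hl, -, ⟨u, hu, v, hv, rfl⟩, rfl⟩ := Set.mem_iUnion₂.1 hx
    exact ⟨l, hl, ((u, (F₁ u).toReal), v, (F₂ v).toReal),
      ⟨EReal.le_coe_toReal hu, EReal.le_coe_toReal hv⟩, by simp only [hT]⟩
  have hnebot : legendreFenchel (fun x => F₁ x + F₂ x) ξ ≠ ⊥ := by
    obtain ⟨⟨⟨u, s⟩, v, t⟩, ⟨hu, hv⟩, huv⟩ := hCconv.exists_map_eq_zero T S hTC hTS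
    obtain rfl : u = v := by rwa [hT, sub_eq_zero] at huv
    change F₁ u ≤ s at hu
    change F₂ u ≤ t at hv
    refine ne_bot_of_le_ne_bot (EReal.coe_ne_bot (ξ u - (s + t))) ?_
    push_cast
    exact (EReal.sub_le_sub le_rfl (add_le_add hu hv)).trans
      (le_legendreFenchel (fun x => F₁ x + F₂ x) ξ u)
  lift legendreFenchel (fun x => F₁ x + F₂ x) ξ to ℝ using ⟨htop, hnebot⟩ with α hα
  obtain ⟨η, hη⟩ := hCconv.exists_lagrange_multiplier T hCclosed S hTC hTS
    ((τ - ξ.comp π).coprod τ) (a := -α) (by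
      rintro ⟨⟨u, s⟩, v, t⟩ ⟨hu, hv⟩ huv
      obtain rfl : u = v := by rwa [hT, sub_eq_zero] at huv
      change F₁ u ≤ s at hu
      change F₂ u ≤ t at hv
      have h := (EReal.sub_le_sub le_rfl (add_le_add hu hv)).trans
        ((le_legendreFenchel (fun x => F₁ x + F₂ x) ξ u).trans_eq hα.symm)
      norm_cast at h
      simp [π, τ]
      linarith)
  refine ⟨-η, EReal.iSup_add_iSup_le fun u v => ?_⟩
  rcases eq_or_ne (F₁ u) ⊤ with h₁ | h₁
  · simp [h₁]
  rcases eq_or_ne (F₂ v) ⊤ with h₂ | h₂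
  · simp [h₂]
  have h := hη ((u, (F₁ u).toReal), v, (F₂ v).toReal)
    ⟨EReal.le_coe_toReal h₁, EReal.le_coe_toReal h₂⟩
  rw [hT] at h
  simp only [π, τ, ContinuousLinearMap.coprod_apply, sub_apply,
    ContinuousLinearMap.comp_apply, ContinuousLinearMap.coe_fst',
    ContinuousLinearMap.coe_snd', map_sub] at h
  lift F₁ u to ℝ using ⟨h₁, hbot₁ u⟩ with s
  lift F₂ v to ℝ using ⟨h₂, hbot₂ v⟩ with t
  norm_cast
  simp only [EReal.toReal_coe, sub_neg_eq_add, add_apply,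
    neg_apply] at h ⊢
  linarith
end

section
/- Let U and V be real Banach spaces with U reflexive (the canonical embedding of U into its double dual U** is surjective), let J : U → V be an injective bounded linear map, let H be a real Hilbert space and K : V → H an injective bounded linear map. Let a : V × V → ℝ be a bounded, symmetric bilinear form with a(v,v) ≥ c‖v‖²_V for some c > 0, and set Ψ(v) = a(v,v). Let E : V → ℝ ∪ {+∞} be proper, nonnegative, sequentially weakly lower semicontinuous on V, with effective domain contained in the range of J. Assume there exists τ₀ > 0 such that for every v₀ ∈ V and every c₁ ∈ ℝ, the set {u ∈ U : E(Ju) + τ₀ Ψ((Ju − v₀)/τ₀) ≤ c₁} is bounded in U. Then for every r ∈ (0, τ₀), every v, w ∈ V, and every η ∈ V*, the functional Φ : V → ℝ ∪ {+∞} defined by Φ(u) = (1/(2r²))‖Ku − 2Kv + Kw‖²_H + r Ψ((u − v)/r) + E(u) − ⟨η, u⟩ is bounded from below, its infimum over V is finite, and the infimum is attained at some u* ∈ V with E(u*) < +∞. -/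
open Filter Topology

/-- Bounded sequences in a Hilbert space have weakly convergent subsequences. -/
theorem exists_weakly_convergent_subseq_of_hilbert {X : Type*} [NormedAddCommGroup X]
    [InnerProductSpace ℝ X] [CompleteSpace X] (x : ℕ → X) (C : ℝ) (hx : ∀ n, ‖x n‖ ≤ C) :
    ∃ (k : ℕ → ℕ) (z : X), StrictMono k ∧
      ∀ φ : X →L[ℝ] ℝ, Tendsto (fun n => φ (x (k n))) atTop (𝓝 (φ z)) := by
  let W : Submodule ℝ X := (Submodule.span ℝ (Set.range x)).topologicalClosure
  have hWc : IsClosed (W : Set X) := Submodule.isClosed_topologicalClosure _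
  have : CompleteSpace W := hWc.completeSpace_coe
  have hsep : TopologicalSpace.IsSeparable (W : Set X) :=
    ((Set.countable_range x).isSeparable.span (R := ℝ)).closure
  have : TopologicalSpace.SeparableSpace W := hsep.separableSpace
  have hmem : ∀ n, x n ∈ W := fun n =>
    Submodule.le_topologicalClosure _ (Submodule.subset_span ⟨n, rfl⟩)
  let y : ℕ → W := fun n => ⟨x n, hmem n⟩
  let f : ℕ → WeakDual ℝ W := fun n =>
    StrongDual.toWeakDual (InnerProductSpace.toDual ℝ W (y n))
  obtain ⟨g, -, k, hk, hlim⟩ := WeakDual.isSeqCompact_closedBall ℝ W 0 C (x := f) fun n => by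
    have h : ‖InnerProductSpace.toDual ℝ W (y n)‖ ≤ C := by
      rw [LinearIsometryEquiv.norm_map]
      exact hx n
    exact mem_closedBall_zero_iff.2 h
  let z : W := (InnerProductSpace.toDual ℝ W).symm (WeakDual.toStrongDual g)
  refine ⟨k, z, hk, fun φ => ?_⟩
  have hrep : ∀ u : W, φ u = inner ℝ u
      ((InnerProductSpace.toDual ℝ W).symm (φ.comp W.subtypeL)) := fun u => by
    rw [real_inner_comm, InnerProductSpace.toDual_symm_apply]
    rfl
  have heval := (WeakDual.eval_continuous
    ((InnerProductSpace.toDual ℝ W).symm (φ.comp W.subtypeL))).tendsto g |>.comp hlim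
  have hz : φ z = g ((InnerProductSpace.toDual ℝ W).symm (φ.comp W.subtypeL)) := by
    rw [hrep, InnerProductSpace.toDual_symm_apply]
    rfl
  rw [hz]
  exact heval.congr fun n => (hrep (y (k n))).symm

/-- A copy of `V`, to be equipped with the inner product given by a coercive form on `V`. -/
def Renormed (V : Type*) := V

instance {V : Type*} [AddCommGroup V] : AddCommGroup (Renormed V) :=
  inferInstanceAs (AddCommGroup V)

instance {V : Type*} [AddCommGroup V] [Module ℝ V] : Module ℝ (Renormed V) :=
  inferInstanceAs (Module ℝ V)

/-- Bounded sequences in a Banach space carrying a bounded symmetric coercive bilinear form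
have weakly convergent subsequences. -/
theorem exists_weakly_convergent_subseq_of_coercive {V : Type*} [NormedAddCommGroup V]
    [NormedSpace ℝ V] [CompleteSpace V] (a : V →L[ℝ] V →L[ℝ] ℝ)
    (hsymm : ∀ v w : V, a v w = a w v) (c : ℝ) (hc : 0 < c)
    (hcoer : ∀ v : V, c * ‖v‖ ^ 2 ≤ a v v) (x : ℕ → V) (C : ℝ) (hx : ∀ n, ‖x n‖ ≤ C) :
    ∃ (k : ℕ → ℕ) (z : V), StrictMono k ∧
      ∀ φ : V →L[ℝ] ℝ, Tendsto (fun n => φ (x (k n))) atTop (𝓝 (φ z)) := by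
  let l : V ≃ₗ[ℝ] Renormed V := LinearEquiv.refl ℝ V
  let core : InnerProductSpace.Core ℝ (Renormed V) :=
    { inner := fun v w => a (l.symm v) (l.symm w)
      conj_inner_symm := fun v w => hsymm _ _
      re_inner_nonneg := fun v =>
        (by positivity : (0 : ℝ) ≤ c * ‖l.symm v‖ ^ 2).trans (hcoer (l.symm v))
      add_left := fun u v w => by
        rw [map_add, map_add, add_apply]
      smul_left := fun v w t => by
        rw [map_smul, map_smul, smul_apply, smul_eq_mul]
        rfl
      definite := fun v hv => by
        have h : ‖l.symm v‖ ^ 2 ≤ 0 := le_of_mul_le_mul_left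
          ((hcoer _).trans (hv.le.trans_eq (mul_zero c).symm)) hc
        have h' : l.symm v = 0 := by simpa using le_antisymm h (sq_nonneg _)
        simpa using h' }
  let _ : NormedAddCommGroup (Renormed V) := core.toNormedAddCommGroup
  let _ : InnerProductSpace ℝ (Renormed V) := InnerProductSpace.ofCore core.toCore
  have hnorm : ∀ v : V, ‖l v‖ ^ 2 = a v v := fun v =>
    (real_inner_self_eq_norm_sq (l v)).symm
  have hupper : ∀ v : V, ‖l v‖ ≤ √‖a‖ * ‖v‖ := fun v => by
    refine (abs_le_of_sq_le_sq' ?_ (by positivity)).2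
    rw [mul_pow, Real.sq_sqrt (norm_nonneg a), hnorm]
    refine (Real.le_norm_self _).trans ((a.le_opNorm₂ v v).trans_eq ?_)
    ring
  let e : V ≃L[ℝ] Renormed V := l.toContinuousLinearEquivOfBounds (√‖a‖) (√c)⁻¹ hupper
    (fun v => by
      refine (abs_le_of_sq_le_sq' ?_ (by positivity)).2
      rw [mul_pow, inv_pow, Real.sq_sqrt hc.le, le_inv_mul_iff₀ hc]
      exact (hcoer _).trans_eq (hnorm (l.symm v)).symm)
  have : CompleteSpace (Renormed V) :=
    (completeSpace_congr (e := e.toEquiv) e.isUniformEmbedding).1 inferInstance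
  obtain ⟨k, z, hk, hz⟩ := exists_weakly_convergent_subseq_of_hilbert (fun n => e (x n))
    (√‖a‖ * C) fun n =>
      (hupper (x n)).trans (mul_le_mul_of_nonneg_left (hx n) (Real.sqrt_nonneg _))
  refine ⟨k, e.symm z, hk, fun φ => ?_⟩
  simpa using hz (φ.comp (e.symm : Renormed V →L[ℝ] V))

/-- Direct method: a functional `Q + E` attains a finite infimum when `Q` is real-valued,
bounded below, has bounded sublevels and supporting affine functionals, `E` is proper,
nonnegative and sequentially weakly lower semicontinuous, and bounded sequences have weakly
convergent subsequences. -/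
theorem exists_minimizer_of_supported {V : Type*} [NormedAddCommGroup V] [NormedSpace ℝ V]
    (hcpt : ∀ (x : ℕ → V) (C : ℝ), (∀ n, ‖x n‖ ≤ C) → ∃ (k : ℕ → ℕ) (z : V), StrictMono k ∧
      ∀ φ : V →L[ℝ] ℝ, Tendsto (fun n => φ (x (k n))) atTop (𝓝 (φ z)))
    (E : V → EReal) (hproper : ∃ v, E v ≠ ⊤) (hnonneg : ∀ v, 0 ≤ E v)
    (hwlsc : ∀ (un : ℕ → V) (u : V),
      (∀ φ : V →L[ℝ] ℝ, Tendsto (fun n => φ (un n)) atTop (𝓝 (φ u))) →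
      E u ≤ liminf (fun n => E (un n)) atTop)
    (Q : V → ℝ) (m : ℝ) (hm : ∀ u, m ≤ Q u)
    (hbdd : ∀ M : ℝ, ∃ C : ℝ, ∀ u, Q u ≤ M → ‖u‖ ≤ C)
    (hsupp : ∀ u, ∃ φ : V →L[ℝ] ℝ, ∀ u', Q u + φ (u' - u) ≤ Q u') :
    (∃ m : ℝ, ∀ u : V, (m : EReal) ≤ (Q u : EReal) + E u) ∧
      (⨅ u : V, (Q u : EReal) + E u) ≠ ⊤ ∧ (⨅ u : V, (Q u : EReal) + E u) ≠ ⊥ ∧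
      ∃ ustar : V, E ustar ≠ ⊤ ∧ (Q ustar : EReal) + E ustar = ⨅ u : V, (Q u : EReal) + E u := by
  have hQE : ∀ u, (Q u : EReal) ≤ (Q u : EReal) + E u := fun u =>
    le_add_of_nonneg_right (hnonneg u)
  have hlow : ∀ u, (m : EReal) ≤ (Q u : EReal) + E u := fun u =>
    (EReal.coe_le_coe_iff.2 (hm u)).trans (hQE u)
  have hbot : (⨅ u : V, (Q u : EReal) + E u) ≠ ⊥ :=
    ne_bot_of_le_ne_bot (EReal.coe_ne_bot m) (le_iInf hlow)
  have htop : (⨅ u : V, (Q u : EReal) + E u) ≠ ⊤ := by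
    obtain ⟨v, hv⟩ := hproper
    exact ne_top_of_le_ne_top (EReal.add_ne_top (EReal.coe_ne_top _) hv) (iInf_le _ v)
  refine ⟨⟨m, hlow⟩, htop, hbot, ?_⟩
  obtain ⟨I, hI⟩ : ∃ I : ℝ, (I : EReal) = ⨅ u : V, (Q u : EReal) + E u :=
    ⟨_, EReal.coe_toReal htop hbot⟩
  have hseq : ∀ n : ℕ, ∃ u, (Q u : EReal) + E u < ((I + 1 / ((n : ℝ) + 1) : ℝ) : EReal) := by
    intro n
    refine iInf_lt_iff.1 ?_
    rw [← hI, EReal.coe_lt_coe_iff]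
    exact lt_add_of_pos_right _ Nat.one_div_pos_of_nat
  choose x hx using hseq
  obtain ⟨C, hC⟩ := hbdd (I + 1)
  obtain ⟨k, z, hk, hz⟩ := hcpt x C fun n => hC _ <| by
    have h1 : Q (x n) < I + 1 / ((n : ℝ) + 1) :=
      EReal.coe_lt_coe_iff.1 ((hQE _).trans_lt (hx n))
    have h2 : 1 / ((n : ℝ) + 1) ≤ 1 := by
      rw [div_le_one (by positivity)]
      linarith [n.cast_nonneg (α := ℝ)]
    linarith
  obtain ⟨φ, hφ⟩ := hsupp z
  let g : ℕ → ℝ := fun n => I + 1 / ((k n : ℝ) + 1) - Q z - (φ (x (k n)) - φ z)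
  have hg : Tendsto g atTop (𝓝 (I - Q z)) := by
    have h1 : Tendsto (fun n => 1 / ((k n : ℝ) + 1)) atTop (𝓝 0) :=
      tendsto_one_div_add_atTop_nhds_zero_nat.comp hk.tendsto_atTop
    simpa [g] using ((h1.const_add I).sub_const (Q z)).sub ((hz φ).sub_const (φ z))
  have hEg : ∀ n, E (x (k n)) ≤ (g n : EReal) := fun n => by
    have h := hx (k n)
    have h0 := hnonneg (x (k n))
    have h1 := hφ (x (k n))
    rw [map_sub] at h1
    generalize E (x (k n)) = t at h h0
    induction t with
    | bot => exact bot_le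
    | top => simp at h
    | coe t =>
      rw [← EReal.coe_add, EReal.coe_lt_coe_iff] at h
      rw [EReal.coe_le_coe_iff]
      simp only [g]
      linarith
  have hEz : E z ≤ ((I - Q z : ℝ) : EReal) := by
    refine (hwlsc _ z hz).trans ((liminf_le_liminf (Eventually.of_forall hEg)).trans_eq ?_)
    exact ((continuous_coe_real_ereal.tendsto _).comp hg).liminf_eq
  refine ⟨z, ne_top_of_le_ne_top (EReal.coe_ne_top _) hEz, le_antisymm ?_ (iInf_le _ z)⟩
  rw [← hI]
  refine (add_le_add_right hEz _).trans_eq ?_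
  rw [← EReal.coe_add]
  simp

/-- Existence of minimizers for the incremental functional of the semi-implicit
variational scheme: under reflexivity of `U`, compatible embeddings `J : U → V`,
`K : V → H`, a strongly positive symmetric bounded bilinear dissipation
`Ψ(v) = a(v,v)`, and an energy `E` that is proper, nonnegative, sequentially weakly
lower semicontinuous, with effective domain in the range of `J`, and with bounded
sublevels of `u ↦ E(Ju) + τ₀Ψ((Ju − v₀)/τ₀)` in `U`, the functional
`Φ(u) = (1/(2r²))‖Ku − 2Kv + Kw‖² + rΨ((u − v)/r) + E(u) − ⟨η, u⟩`
is bounded below, has finite infimum, and attains its infimum at a point of the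
effective domain of `E`, for every `0 < r < τ₀`, `v, w ∈ V`, `η ∈ V*`. -/
theorem incremental_minimization {U V H : Type*}
    [NormedAddCommGroup U] [NormedSpace ℝ U] [CompleteSpace U]
    [NormedAddCommGroup V] [NormedSpace ℝ V] [CompleteSpace V]
    [NormedAddCommGroup H] [InnerProductSpace ℝ H] [CompleteSpace H]
    (hrefl : Function.Surjective (NormedSpace.inclusionInDoubleDual ℝ U))
    (J : U →L[ℝ] V) (hJ : Function.Injective J)
    (K : V →L[ℝ] H) (hK : Function.Injective K)
    (a : V →L[ℝ] V →L[ℝ] ℝ) (hsymm : ∀ v w : V, a v w = a w v)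
    (c : ℝ) (hc : 0 < c) (hcoer : ∀ v : V, c * ‖v‖ ^ 2 ≤ a v v)
    (E : V → EReal)
    (hbot : ∀ v, E v ≠ ⊥) (hproper : ∃ v, E v ≠ ⊤) (hnonneg : ∀ v, 0 ≤ E v)
    (hwlsc : ∀ (un : ℕ → V) (u : V),
      (∀ φ : V →L[ℝ] ℝ, Tendsto (fun n => φ (un n)) atTop (𝓝 (φ u))) →
      E u ≤ liminf (fun n => E (un n)) atTop)
    (hdom : ∀ v : V, E v ≠ ⊤ → v ∈ Set.range J)
    (τ₀ : ℝ) (hτ₀ : 0 < τ₀)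
    (hcoerE : ∀ (v₀ : V) (c₁ : ℝ), Bornology.IsBounded
      {u : U | E (J u) +
        ((τ₀ * a (τ₀⁻¹ • (J u - v₀)) (τ₀⁻¹ • (J u - v₀)) : ℝ) : EReal) ≤ (c₁ : EReal)}) :
    ∀ (r : ℝ), 0 < r → r < τ₀ → ∀ (v w : V) (η : V →L[ℝ] ℝ),
      (∃ m : ℝ, ∀ u : V, (m : EReal) ≤
        ((1 / (2 * r ^ 2) * ‖K u - (2 : ℝ) • K v + K w‖ ^ 2
            + r * a (r⁻¹ • (u - v)) (r⁻¹ • (u - v)) - η u : ℝ) : EReal) + E u) ∧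
      (⨅ u : V, ((1 / (2 * r ^ 2) * ‖K u - (2 : ℝ) • K v + K w‖ ^ 2
            + r * a (r⁻¹ • (u - v)) (r⁻¹ • (u - v)) - η u : ℝ) : EReal) + E u) ≠ ⊤ ∧
      (⨅ u : V, ((1 / (2 * r ^ 2) * ‖K u - (2 : ℝ) • K v + K w‖ ^ 2
            + r * a (r⁻¹ • (u - v)) (r⁻¹ • (u - v)) - η u : ℝ) : EReal) + E u) ≠ ⊥ ∧
      ∃ ustar : V, E ustar ≠ ⊤ ∧
        (((1 / (2 * r ^ 2) * ‖K ustar - (2 : ℝ) • K v + K w‖ ^ 2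
            + r * a (r⁻¹ • (ustar - v)) (r⁻¹ • (ustar - v)) - η ustar : ℝ) : EReal)
          + E ustar) =
        ⨅ u : V, ((1 / (2 * r ^ 2) * ‖K u - (2 : ℝ) • K v + K w‖ ^ 2
            + r * a (r⁻¹ • (u - v)) (r⁻¹ • (u - v)) - η u : ℝ) : EReal) + E u := by
  intro r hr _ v w η
  have hna : ∀ h : V, 0 ≤ a h h := fun h =>
    (by positivity : (0 : ℝ) ≤ c * ‖h‖ ^ 2).trans (hcoer h)
  have hscale : ∀ h : V, r * a (r⁻¹ • h) (r⁻¹ • h) = r⁻¹ * a h h := fun h => by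
    simp only [map_smul, smul_apply, smul_eq_mul]
    field_simp
  set Q : V → ℝ := fun u => 1 / (2 * r ^ 2) * ‖K u - (2 : ℝ) • K v + K w‖ ^ 2
    + r * a (r⁻¹ • (u - v)) (r⁻¹ • (u - v)) - η u with hQ
  have hgrowth : ∀ u, r⁻¹ * c * ‖u - v‖ ^ 2 - ‖η‖ * ‖u - v‖ - η v ≤ Q u := fun u => by
    have h1 : (0 : ℝ) ≤ 1 / (2 * r ^ 2) * ‖K u - (2 : ℝ) • K v + K w‖ ^ 2 := by positivity
    have h2 : r⁻¹ * (c * ‖u - v‖ ^ 2) ≤ r⁻¹ * a (u - v) (u - v) :=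
      mul_le_mul_of_nonneg_left (hcoer _) (by positivity)
    have h3 : η (u - v) ≤ ‖η‖ * ‖u - v‖ := (Real.le_norm_self _).trans (η.le_opNorm _)
    rw [map_sub] at h3
    simp only [hQ, hscale]
    linarith
  have hd : 0 < r⁻¹ * c := by positivity
  generalize r⁻¹ * c = d at hgrowth hd
  refine exists_minimizer_of_supported
    (exists_weakly_convergent_subseq_of_coercive a hsymm c hc hcoer) E hproper hnonneg hwlsc Q
    (-(‖η‖ ^ 2 / (4 * d)) - η v) (fun u => ?_) (fun M => ?_) (fun u => ?_)
  · refine le_trans ?_ (hgrowth u)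
    have h : d * ‖u - v‖ ^ 2 - ‖η‖ * ‖u - v‖ + ‖η‖ ^ 2 / (4 * d)
        = (2 * d * ‖u - v‖ - ‖η‖) ^ 2 / (4 * d) := by
      field_simp
      ring
    have h' : 0 ≤ (2 * d * ‖u - v‖ - ‖η‖) ^ 2 / (4 * d) := by positivity
    linarith
  · refine ⟨‖v‖ + ((‖η‖ + |M + η v|) / d + 1), fun u hu => ?_⟩
    have h1 := (hgrowth u).trans hu
    have h2 : ‖u‖ ≤ ‖v‖ + ‖u - v‖ := by
      simpa using norm_add_le v (u - v)
    suffices ‖u - v‖ ≤ (‖η‖ + |M + η v|) / d + 1 by linarith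
    by_contra! h3
    have h4 : 0 ≤ (‖η‖ + |M + η v|) / d := by positivity
    have h5 : ‖η‖ + |M + η v| < d * ‖u - v‖ := by
      rw [← div_lt_iff₀' hd]
      linarith
    have h6 : 1 < ‖u - v‖ := by linarith
    nlinarith [le_abs_self (M + η v), abs_nonneg (M + η v)]
  · let b : H := K u - (2 : ℝ) • K v + K w
    refine ⟨(1 / r ^ 2) • (innerSL ℝ b).comp K + (2 * r⁻¹) • a (u - v) - η, fun u' => ?_⟩
    obtain ⟨h, rfl⟩ : ∃ h, u' = u + h := ⟨u' - u, by abel⟩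
    have h1 : K (u + h) - (2 : ℝ) • K v + K w = b + K h := by
      simp only [b, map_add]
      abel
    have h2 : u + h - v = (u - v) + h := by abel
    have h3 : a ((u - v) + h) ((u - v) + h) = a (u - v) (u - v) + 2 * a (u - v) h + a h h := by
      rw [map_add a, add_apply, map_add, map_add, hsymm h (u - v)]
      ring
    have h4 : 0 ≤ 1 / (2 * r ^ 2) * ‖K h‖ ^ 2 := by positivity
    have h5 : 0 ≤ r⁻¹ * a h h := mul_nonneg (by positivity) (hna h)
    have h6 : 1 / (2 * r ^ 2) * (2 * inner ℝ b (K h)) = 1 / r ^ 2 * inner ℝ b (K h) := by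
      field_simp
    have h7 : Q (u + h) = 1 / (2 * r ^ 2) * (‖b‖ ^ 2 + 2 * inner ℝ b (K h) + ‖K h‖ ^ 2)
        + r⁻¹ * (a (u - v) (u - v) + 2 * a (u - v) h + a h h) - (η u + η h) := by
      simp only [hQ, hscale]
      rw [h1, h2, h3, norm_add_sq_real, map_add η]
    have h8 : Q u = 1 / (2 * r ^ 2) * ‖b‖ ^ 2 + r⁻¹ * a (u - v) (u - v) - η u := by
      simp only [hQ, hscale, b]
    rw [h7, h8, add_sub_cancel_left]
    simp only [sub_apply, add_apply,
      smul_apply, ContinuousLinearMap.comp_apply, innerSL_apply_apply,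
      smul_eq_mul]
    linarith
end
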